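/- Let Σ be a finite subset of ℕ* with |Σ| < q, let w be a positive integer, and let 𝙰 be an admissible array with pairwise disjoint ordinary finite types which is a composition of (Σ, w). Then there exist finitely many elements α_1,…,α_m ∈ F_q and admissible arrays 𝙱_1,…,𝙱_m with pairwise disjoint ordinary finite types, each a composition of (Σ, w), all independent of d, such that for all d ∈ ℕ: S_d(𝙰) = Σ_{i=1}^{m} α_i S_d†(𝙱_i). -/

import Mathlib

/-!
STATEMENT 14: Let `Σ` be a finite subset of `ℕ*` with `|Σ| < q`, `w ≥ 1`, and
let `𝙰` be an admissible array with pairwise disjoint ordinary finite types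
which is a composition of `(Σ, w)`.  Then there exist finitely many
`α_1,…,α_m ∈ F_q` and admissible arrays `𝙱_1,…,𝙱_m` with pairwise disjoint
ordinary finite types, each a composition of `(Σ, w)`, all independent of `d`,
such that for all `d ∈ ℕ`: `S_d(𝙰) = Σ_i α_i S_d†(𝙱_i)` in the polynomial ring
over `K = F_q(θ)` in the indeterminates `t_n`.
-/

open Polynomial Finset

noncomputable section

variable (Fq : Type) [Field Fq] [Fintype Fq]

/-- `q`, the cardinality of the base field. -/
abbrev q := Fintype.card Fq

/-- `θ` as an element of `K = F_q(θ)`. -/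
def th : RatFunc Fq := algebraMap (Polynomial Fq) (RatFunc Fq) Polynomial.X

/-- `a` as an element of `K`. -/
def aK (a : Polynomial Fq) : RatFunc Fq := algebraMap (Polynomial Fq) (RatFunc Fq) a

/-- The canonical map `F_q → K`. -/
def FqK : Fq →+* RatFunc Fq :=
  (algebraMap (Polynomial Fq) (RatFunc Fq)).comp Polynomial.C

/-- The monic polynomial `θ^d + Σ_{i<d} c_i θ^i`; as `c` ranges over `Fin d → Fq`
these are exactly the elements of `A^+(d)`. -/
def mP (d : ℕ) (c : Fin d → Fq) : Polynomial Fq :=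
  Polynomial.X ^ d + ∑ i : Fin d, Polynomial.C (c i) * Polynomial.X ^ (i : ℕ)

/-- `a(t_i)`: substitute `θ` by the indeterminate `t_i` in `a ∈ A`. -/
def tval (i : ℕ+) (a : Polynomial Fq) : MvPolynomial ℕ+ (RatFunc Fq) :=
  Polynomial.eval₂ ((MvPolynomial.C : RatFunc Fq →+* MvPolynomial ℕ+ (RatFunc Fq)).comp (FqK Fq))
    (MvPolynomial.X i) a

/-- The scalar power sum `S_d(s) = Σ_{a∈A^+(d)} a^{−s} ∈ K`. -/
def Ssc (d : ℕ) (s : ℕ) : RatFunc Fq := ∑ c : Fin d → Fq, ((aK Fq (mP Fq d c)) ^ s)⁻¹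

/-- `b_d(t_i) = ∏_{m<d} (t_i − θ^{q^m})` as a polynomial in the variable `t_i`. -/
def bMv (d : ℕ) (i : ℕ+) : MvPolynomial ℕ+ (RatFunc Fq) :=
  ∏ m ∈ Finset.range d, (MvPolynomial.X i - MvPolynomial.C (th Fq ^ q Fq ^ m))

/-- The depth-one power sum `S_d(Σ; s) = Σ_{a∈A^+(d)} χ_Σ(a)/a^s`, where
`χ_Σ(a) = ∏_{i∈Σ} a(t_i)` for an ordinary finite subset `Σ` of `ℕ*`. -/
def S1F (d : ℕ) (Sg : Finset ℕ+) (s : ℕ) : MvPolynomial ℕ+ (RatFunc Fq) :=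
  ∑ c : Fin d → Fq, (∏ i ∈ Sg, tval Fq i (mP Fq d c)) *
    MvPolynomial.C ((aK Fq (mP Fq d c)) ^ s)⁻¹

/-- The depth-one dagger power sum `S_d†(Σ; s) = S_d(s)·b_d(Σ)`, with
`b_d(Σ) = ∏_{i∈Σ} b_d(t_i)`. -/
def S1D (d : ℕ) (Sg : Finset ℕ+) (s : ℕ) : MvPolynomial ℕ+ (RatFunc Fq) :=
  MvPolynomial.C (Ssc Fq d s) * ∏ i ∈ Sg, bMv Fq d i

/-- Power sums of arrays with ordinary finite types (lists of pairs `(Σ_i, s_i)`):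
`S_d(𝙰) = Σ_{d = d_1 > … > d_r ≥ 0} ∏_i S_{d_i}(Σ_i; s_i)`. -/
def SPF : List (Finset ℕ+ × ℕ) → ℕ → MvPolynomial ℕ+ (RatFunc Fq)
  | [], d => if d = 0 then 1 else 0
  | [x], d => S1F Fq d x.1 x.2
  | x :: y :: L, d => S1F Fq d x.1 x.2 * ∑ k ∈ Finset.range d, SPF (y :: L) k

/-- Dagger power sums of arrays with ordinary finite types:
`S_d†(𝙰) = Σ_{d = d_1 > … > d_r ≥ 0} ∏_i S_{d_i}(s_i) b_{d_i}(Σ_i)`. -/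
def SPD : List (Finset ℕ+ × ℕ) → ℕ → MvPolynomial ℕ+ (RatFunc Fq)
  | [], d => if d = 0 then 1 else 0
  | [x], d => S1D Fq d x.1 x.2
  | x :: y :: L, d => S1D Fq d x.1 x.2 * ∑ k ∈ Finset.range d, SPD (y :: L) k

/-- `𝙰` is an admissible array (with pairwise disjoint ordinary finite types)
which is a composition of `(Σ, w)`: all exponents are positive, the types are
pairwise disjoint with union `Σ`, and the exponents add up to `w`. -/
def IsCompF (L : List (Finset ℕ+ × ℕ)) (Sg : Finset ℕ+) (w : ℕ) : Prop :=
  (∀ x ∈ L, 1 ≤ x.2) ∧ L.Pairwise (fun x y => Disjoint x.1 y.1) ∧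
    (L.map Prod.fst).foldr (· ∪ ·) ∅ = Sg ∧ (L.map Prod.snd).sum = w

set_option linter.unusedSectionVars false

/-- The polynomial `Σ_{i<d} c_i θ^i` of degree less than `d` with coefficients `c`. -/
def lowPoly (d : ℕ) (c : Fin d → Fq) : Polynomial Fq :=
  ∑ i : Fin d, Polynomial.C (c i) * Polynomial.X ^ (i : ℕ)

theorem mP_eq (d : ℕ) (c : Fin d → Fq) : mP Fq d c = Polynomial.X ^ d + lowPoly Fq d c := rfl

theorem lowPoly_sub (d : ℕ) (c c' : Fin d → Fq) :
    lowPoly Fq d (c - c') = lowPoly Fq d c - lowPoly Fq d c' := by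
  simp [lowPoly, sub_mul, Finset.sum_sub_distrib]

theorem lowPoly_smul (d : ℕ) (f : Fq) (c : Fin d → Fq) :
    lowPoly Fq d (f • c) = Polynomial.C f * lowPoly Fq d c := by
  simp [lowPoly, Finset.mul_sum, mul_assoc]

theorem coeff_lowPoly (d : ℕ) (c : Fin d → Fq) (i : Fin d) :
    (lowPoly Fq d c).coeff i = c i := by
  simp [lowPoly, Polynomial.coeff_C_mul, Polynomial.coeff_X_pow,
    Fin.val_inj]

theorem lowPoly_injective (d : ℕ) : Function.Injective (lowPoly Fq d) := by
  intro c c' h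
  ext i
  rw [← coeff_lowPoly Fq d c i, h, coeff_lowPoly]

theorem lowPoly_snoc (d : ℕ) (f : Fq) (c : Fin d → Fq) :
    lowPoly Fq (d + 1) (Fin.snoc (α := fun _ => Fq) c f)
      = lowPoly Fq d c + Polynomial.C f * Polynomial.X ^ d := by
  simp [lowPoly, Fin.sum_univ_castSucc]

theorem degree_lowPoly_lt (d : ℕ) (c : Fin d → Fq) : (lowPoly Fq d c).degree < d :=
  Polynomial.degree_sum_fin_lt c

theorem mP_ne_zero (d : ℕ) (c : Fin d → Fq) : mP Fq d c ≠ 0 :=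
  (Polynomial.monic_X_pow_add (degree_lowPoly_lt Fq d c)).ne_zero

theorem aK_injective : Function.Injective (aK Fq) := RatFunc.algebraMap_injective Fq

theorem aK_mP_ne_zero (d : ℕ) (c : Fin d → Fq) : aK Fq (mP Fq d c) ≠ 0 := fun h =>
  mP_ne_zero Fq d c (aK_injective Fq (h.trans (map_zero _).symm))

theorem aK_mP_injective (d : ℕ) : Function.Injective fun c => aK Fq (mP Fq d c) := fun _ _ h =>
  lowPoly_injective Fq d (add_left_cancel (aK_injective Fq h))

theorem aK_mP_sub (d : ℕ) (c c' : Fin d → Fq) :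
    aK Fq (mP Fq d c) - aK Fq (mP Fq d c') = aK Fq (lowPoly Fq d (c - c')) := by
  simp [mP_eq, lowPoly_sub, aK]

/-- Summing `u^{-j}` over all `u` of degree `< d` (with `0⁻¹ = 0`) gives a multiple of
`Σ_{k<d} S_k(j)`. -/
theorem sum_inv_lowPoly_pow (j : ℕ) (hj : 1 ≤ j) (d : ℕ) :
    ∑ c : Fin d → Fq, ((aK Fq (lowPoly Fq d c)) ^ j)⁻¹
      = FqK Fq (∑ f : Fq, (f ^ j)⁻¹) * ∑ k ∈ Finset.range d, Ssc Fq k j := by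
  classical
  induction d with
  | zero => simp [lowPoly, aK, show j ≠ 0 by omega]
  | succ d ih =>
    rw [← (Fin.snocEquiv fun _ => Fq).sum_comp, Fintype.sum_prod_type,
      Finset.sum_range_succ, mul_add, ← ih]
    have key (f : Fq) (hf : f ≠ 0) :
        ∑ c : Fin d → Fq, ((aK Fq (lowPoly Fq d c + Polynomial.C f * Polynomial.X ^ d)) ^ j)⁻¹
          = FqK Fq (f ^ j)⁻¹ * Ssc Fq d j := by
      rw [← (MulAction.bijective (Units.mk0 f hf)).sum_comp, Ssc, Finset.mul_sum]
      refine Finset.sum_congr rfl fun c _ => ?_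
      have : lowPoly Fq d (Units.mk0 f hf • c) + Polynomial.C f * Polynomial.X ^ d
          = Polynomial.C f * mP Fq d c := by
        rw [mP_eq, Units.smul_def, Units.val_mk0, lowPoly_smul]; ring
      rw [this]
      simp [aK, FqK, mul_pow, mul_comm]
    rw [← Finset.add_sum_erase _ _ (Finset.mem_univ (0 : Fq)),
      ← Finset.add_sum_erase _ (fun f : Fq => (f ^ j)⁻¹) (Finset.mem_univ (0 : Fq))]
    congr 1
    · simp [Fin.snocEquiv, lowPoly_snoc]
    · rw [zero_pow (by omega), inv_zero, zero_add, map_sum, Finset.sum_mul]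
      refine Finset.sum_congr rfl fun f hf => ?_
      rw [← key f (Finset.ne_of_mem_erase hf)]
      simp [Fin.snocEquiv, lowPoly_snoc]

/-- Partial fractions: if `uv = z(v - u)`, then `u^s v^r` is an integral combination of the
monomials `z^j u^{s+r-j}` and `z^j v^{s+r-j}`, with coefficients depending only on `s` and `r`. -/
theorem exists_partial_fraction (n : ℕ) : ∀ s r : ℕ, 1 ≤ s → 1 ≤ r → s + r = n →
    ∃ a b : ℕ → ℤ, ∀ {R : Type} [CommRing R] (u v z : R), u * v = z * (v - u) →
      u ^ s * v ^ r = ∑ j ∈ Finset.Ico 1 n, z ^ j * (a j * u ^ (n - j) + b j * v ^ (n - j)) := by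
  induction n with
  | zero => intro s r hs hr h; omega
  | succ n ih =>
    have half (s r : ℕ) (hsr : s + r = n) (hn : 1 ≤ n) :
        ∃ a b : ℕ → ℤ, ∀ {R : Type} [CommRing R] (u v z : R), u * v = z * (v - u) →
          z * (u ^ s * v ^ r)
            = ∑ j ∈ Finset.Ico 1 (n + 1), z ^ j * (a j * u ^ (n + 1 - j) + b j * v ^ (n + 1 - j)) := by
      rcases Nat.eq_zero_or_pos s with rfl | hs
      · refine ⟨0, Pi.single 1 1, fun {R} _ u v z _ => ?_⟩
        rw [Finset.sum_eq_single_of_mem 1 (by simp; omega)]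
        · obtain rfl : r = n := by omega
          simp
        · intro j _ hj; simp [hj]
      rcases Nat.eq_zero_or_pos r with rfl | hr
      · refine ⟨Pi.single 1 1, 0, fun {R} _ u v z _ => ?_⟩
        rw [Finset.sum_eq_single_of_mem 1 (by simp; omega)]
        · obtain rfl : s = n := by omega
          simp
        · intro j _ hj; simp [hj]
      obtain ⟨a, b, h⟩ := ih s r hs hr hsr
      refine ⟨fun j => if j = 1 then 0 else a (j - 1), fun j => if j = 1 then 0 else b (j - 1),
        fun {R} _ u v z huv => ?_⟩
      rw [h u v z huv, Finset.sum_eq_sum_Ico_succ_bot (by omega : 1 < n + 1), Finset.mul_sum,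
        ← Finset.sum_Ico_add' _ 1 n 1]
      simp only [if_true, Int.cast_zero, zero_mul, add_zero, mul_zero, zero_add]
      refine Finset.sum_congr rfl fun j hj => ?_
      have hj1 : 1 ≤ j := (Finset.mem_Ico.1 hj).1
      rw [if_neg (by omega), if_neg (by omega), Nat.add_sub_cancel,
        show n + 1 - (j + 1) = n - j by omega]
      ring
    intro s r hs hr hsr
    obtain ⟨a, b, h⟩ := half (s - 1) r (by omega) (by omega)
    obtain ⟨a', b', h'⟩ := half s (r - 1) (by omega) (by omega)
    refine ⟨a - a', b - b', fun {R} _ u v z huv => ?_⟩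
    have : u ^ s * v ^ r = z * (u ^ (s - 1) * v ^ r) - z * (u ^ s * v ^ (r - 1)) := by
      obtain ⟨s, rfl⟩ := Nat.exists_eq_add_of_le' hs
      obtain ⟨r, rfl⟩ := Nat.exists_eq_add_of_le' hr
      simp only [Nat.add_sub_cancel, pow_succ]
      linear_combination u ^ s * v ^ r * huv
    rw [this, h u v z huv, h' u v z huv, ← Finset.sum_sub_distrib]
    refine Finset.sum_congr rfl fun j _ => ?_
    simp only [Pi.sub_apply, Int.cast_sub]
    ring

/-- The product of two scalar power sums of the same degree. -/
theorem exists_Ssc_mul (s r : ℕ) (hs : 1 ≤ s) (hr : 1 ≤ r) :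
    ∃ δ : ℕ → Fq, ∀ d, Ssc Fq d s * Ssc Fq d r = Ssc Fq d (s + r) +
      ∑ j ∈ Finset.Ico 1 (s + r),
        FqK Fq (δ j) * (Ssc Fq d (s + r - j) * ∑ k ∈ Finset.range d, Ssc Fq k j) := by
  classical
  obtain ⟨a, b, h⟩ := exists_partial_fraction (s + r) s r hs hr rfl
  refine ⟨fun j => (a j + (-1) ^ j * b j) * ∑ f : Fq, (f ^ j)⁻¹, fun d => ?_⟩
  let u (c : Fin d → Fq) : RatFunc Fq := (aK Fq (mP Fq d c))⁻¹
  let z (c : Fin d → Fq) : RatFunc Fq := (aK Fq (lowPoly Fq d c))⁻¹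
  have hS (n : ℕ) : Ssc Fq d n = ∑ c, u c ^ n := by simp [Ssc, u]
  have hz (j : ℕ) (hj : 1 ≤ j) : ∑ c, z c ^ j
      = FqK Fq (∑ f : Fq, (f ^ j)⁻¹) * ∑ k ∈ Finset.range d, Ssc Fq k j := by
    simp only [← sum_inv_lowPoly_pow Fq j hj d, z, inv_pow]
  have pair (c c' : Fin d → Fq) : u c ^ s * u c' ^ r = (if c = c' then u c ^ (s + r) else 0) +
      ∑ j ∈ Finset.Ico 1 (s + r),
        z (c - c') ^ j * (a j * u c ^ (s + r - j) + b j * u c' ^ (s + r - j)) := by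
    by_cases hc : c = c'
    · subst hc
      rw [if_pos rfl, Finset.sum_eq_zero, pow_add, add_zero]
      intro j hj
      have : j ≠ 0 := by have := (Finset.mem_Ico.1 hj).1; omega
      simp [z, lowPoly, aK, this]
    · rw [if_neg hc, zero_add]
      refine h _ _ _ ?_
      have h1 := aK_mP_ne_zero Fq d c
      have h2 := aK_mP_ne_zero Fq d c'
      have h3 : aK Fq (mP Fq d c) - aK Fq (mP Fq d c') ≠ 0 :=
        sub_ne_zero.2 fun e => hc (aK_mP_injective Fq d e)
      simp only [u, z, ← aK_mP_sub]
      field_simp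
  have left (j n : ℕ) : ∑ c, ∑ c', z (c - c') ^ j * u c ^ n = (∑ c, z c ^ j) * ∑ c, u c ^ n := by
    rw [Finset.mul_sum]
    refine Finset.sum_congr rfl fun c _ => ?_
    rw [← Finset.sum_mul, ← (Equiv.subLeft c).sum_comp fun x => z x ^ j]
    rfl
  have right (j n : ℕ) : ∑ c, ∑ c', z (c - c') ^ j * u c' ^ n
      = (-1) ^ j * ((∑ c, z c ^ j) * ∑ c, u c ^ n) := by
    rw [← left, Finset.sum_comm, Finset.mul_sum]
    refine Finset.sum_congr rfl fun c _ => ?_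
    rw [Finset.mul_sum]
    refine Finset.sum_congr rfl fun c' _ => ?_
    have : z (c' - c) = -z (c - c') := by
      simp only [z, ← aK_mP_sub]
      rw [← inv_neg, neg_sub]
    rw [this, neg_pow, mul_assoc]
  rw [hS s, hS r, Finset.sum_mul_sum]
  simp_rw [pair, Finset.sum_add_distrib]
  congr 1
  · simp [hS]
  · simp_rw [Finset.sum_comm (t := Finset.Ico 1 (s + r))]
    refine Finset.sum_congr rfl fun j hj => ?_
    have e : ∑ c, ∑ c', z (c - c') ^ j * (a j * u c ^ (s + r - j) + b j * u c' ^ (s + r - j))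
        = a j * ∑ c, ∑ c', z (c - c') ^ j * u c ^ (s + r - j)
          + b j * ∑ c, ∑ c', z (c - c') ^ j * u c' ^ (s + r - j) := by
      simp only [Finset.mul_sum, ← Finset.sum_add_distrib]
      refine Finset.sum_congr rfl fun c _ => Finset.sum_congr rfl fun c' _ => ?_
      ring
    rw [e, left, right, hz j (Finset.mem_Ico.1 hj).1, hS]
    simp only [map_mul, map_add, map_pow, map_neg, map_one, map_intCast]
    ring

/-- The power sums `Σ_{a∈A^+(d)} a^k` vanish for `k < q^d - 1`. -/
theorem sum_aK_mP_pow_eq_zero (d k : ℕ) (hk : k + 1 < q Fq ^ d) :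
    ∑ c : Fin d → Fq, aK Fq (mP Fq d c) ^ k = 0 := by
  classical
  have hcard : (Finset.univ : Finset (Fin d → Fq)).card = q Fq ^ d := by simp
  have hlag := Lagrange.coeff_eq_sum (s := (Finset.univ : Finset (Fin d → Fq)))
    (aK_mP_injective Fq d).injOn (P := (Polynomial.X ^ k : (RatFunc Fq)[X]))
    (by rw [Polynomial.degree_X_pow, hcard]; exact_mod_cast (by omega : k < q Fq ^ d))
  have hw (c : Fin d → Fq) :
      ∏ c' ∈ Finset.univ.erase c, (aK Fq (mP Fq d c) - aK Fq (mP Fq d c'))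
        = ∏ u ∈ Finset.univ.erase (0 : Fin d → Fq), aK Fq (lowPoly Fq d u) := by
    refine Finset.prod_bij' (fun c' _ => c - c') (fun u _ => c - u) ?_ ?_ ?_ ?_ ?_
    · intro c' hc'
      simpa [sub_eq_zero, eq_comm] using hc'
    · intro u hu
      simpa using hu
    · simp
    · simp
    · intro c' _
      exact aK_mP_sub Fq d c c'
  have hw0 : ∏ u ∈ Finset.univ.erase (0 : Fin d → Fq), aK Fq (lowPoly Fq d u) ≠ 0 := by
    rw [← hw 0, Finset.prod_ne_zero_iff]
    intro c' hc'
    exact sub_ne_zero.2 fun e => Finset.ne_of_mem_erase hc' (aK_mP_injective Fq d e).symm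
  simp only [hw, Polynomial.eval_pow, Polynomial.eval_X, Polynomial.coeff_X_pow, hcard,
    ← Finset.sum_div] at hlag
  rw [if_neg (by omega), eq_comm, div_eq_zero_iff] at hlag
  exact hlag.resolve_right hw0

/-- `[j] = θ^{q^j} - θ`. -/
def brk (j : ℕ) : RatFunc Fq := th Fq ^ q Fq ^ j - th Fq

theorem brk_succ_ne_zero (j : ℕ) : brk Fq (j + 1) ≠ 0 := by
  intro h
  have h1 : (Polynomial.X ^ q Fq ^ (j + 1) : Fq[X]) = Polynomial.X := by
    apply aK_injective Fq
    simpa [aK, brk, th, sub_eq_zero] using h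
  have h2 := congrArg Polynomial.natDegree h1
  rw [Polynomial.natDegree_X_pow, Polynomial.natDegree_X] at h2
  exact (Nat.one_lt_pow (Nat.succ_ne_zero j) (Fintype.one_lt_card (α := Fq))).ne' h2

/-- The Carlitz polynomials `E_j`, normalised so that `E_j` is `1` on monic polynomials of
degree `j`. -/
def carlitzE : ℕ → (RatFunc Fq)[X]
  | 0 => Polynomial.X
  | j + 1 => Polynomial.C (brk Fq (j + 1))⁻¹ * (carlitzE j ^ q Fq - carlitzE j)

/-- The value of `E_j` as an `F_q`-linear endomorphism of `K`. -/
def carlitzLin (j : ℕ) : RatFunc Fq →ₗ[Fq] RatFunc Fq where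
  toFun x := (carlitzE Fq j).eval x
  map_add' x y := by
    induction j with
    | zero => simp [carlitzE]
    | succ j ih =>
      have := map_add (FiniteField.frobeniusAlgHom Fq (RatFunc Fq)) ((carlitzE Fq j).eval x)
        ((carlitzE Fq j).eval y)
      simp only [FiniteField.frobeniusAlgHom_apply] at this
      simp only [carlitzE, Polynomial.eval_mul, Polynomial.eval_sub, Polynomial.eval_pow,
        Polynomial.eval_C, ih, this]
      ring
  map_smul' a x := by
    induction j with
    | zero => simp [carlitzE]
    | succ j ih =>
      have := map_smul (FiniteField.frobeniusAlgHom Fq (RatFunc Fq)) a ((carlitzE Fq j).eval x)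
      simp only [FiniteField.frobeniusAlgHom_apply] at this
      simp only [RingHom.id_apply] at ih ⊢
      simp only [carlitzE, Polynomial.eval_mul, Polynomial.eval_sub, Polynomial.eval_pow,
        Polynomial.eval_C, ih, this, ← smul_sub, mul_smul_comm]

theorem carlitzLin_zero_apply (x : RatFunc Fq) : carlitzLin Fq 0 x = x := by
  simp [carlitzLin, carlitzE]

theorem brk_mul_carlitzLin_succ (j : ℕ) (x : RatFunc Fq) :
    brk Fq (j + 1) * carlitzLin Fq (j + 1) x = carlitzLin Fq j x ^ q Fq - carlitzLin Fq j x := by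
  simp [carlitzLin, carlitzE, mul_inv_cancel_left₀ (brk_succ_ne_zero Fq j)]

theorem carlitzLin_succ_th_mul (j : ℕ) (x : RatFunc Fq) :
    carlitzLin Fq (j + 1) (th Fq * x)
      = th Fq ^ q Fq ^ (j + 1) * carlitzLin Fq (j + 1) x + carlitzLin Fq j x := by
  apply mul_left_cancel₀ (brk_succ_ne_zero Fq j)
  induction j with
  | zero =>
    have h := brk_mul_carlitzLin_succ Fq 0 x
    rw [brk_mul_carlitzLin_succ, mul_add, mul_left_comm, h]
    simp only [carlitzLin_zero_apply, brk]
    ring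
  | succ j ih =>
    have h := brk_mul_carlitzLin_succ Fq (j + 1) x
    have h' := brk_mul_carlitzLin_succ Fq j x
    have ih' := mul_left_cancel₀ (brk_succ_ne_zero Fq j) ih
    have hfrob := map_add (FiniteField.frobeniusAlgHom Fq (RatFunc Fq))
      (th Fq ^ q Fq ^ (j + 1) * carlitzLin Fq (j + 1) x) (carlitzLin Fq j x)
    simp only [FiniteField.frobeniusAlgHom_apply] at hfrob
    rw [brk_mul_carlitzLin_succ, ih', hfrob, mul_pow, ← pow_mul, ← pow_succ, mul_add,
      mul_left_comm, h]
    simp only [brk] at h' ⊢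
    linear_combination -h'

theorem carlitzLin_th_pow (i : ℕ) : carlitzLin Fq i (th Fq ^ i) = 1 ∧
    ∀ j, i < j → carlitzLin Fq j (th Fq ^ i) = 0 := by
  induction i with
  | zero =>
    refine ⟨by simp [carlitzLin_zero_apply], fun j hj => ?_⟩
    induction j, hj using Nat.le_induction with
    | base =>
      apply mul_left_cancel₀ (brk_succ_ne_zero Fq 0)
      rw [brk_mul_carlitzLin_succ]
      simp [carlitzLin_zero_apply]
    | succ j hj ih =>
      apply mul_left_cancel₀ (brk_succ_ne_zero Fq j)
      rw [brk_mul_carlitzLin_succ, ih, zero_pow Fintype.card_ne_zero]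
      simp
  | succ i ih =>
    refine ⟨?_, fun j hj => ?_⟩
    · rw [pow_succ', carlitzLin_succ_th_mul, ih.2 (i + 1) (by omega), ih.1]
      simp
    · obtain ⟨j, rfl⟩ := Nat.exists_eq_add_of_le' (by omega : 1 ≤ j)
      rw [pow_succ', carlitzLin_succ_th_mul, ih.2 (j + 1) (by omega), ih.2 j (by omega)]
      simp

theorem bMv_succ (d : ℕ) (i : ℕ+) :
    bMv Fq (d + 1) i = bMv Fq d i * (MvPolynomial.X i - MvPolynomial.C (th Fq ^ q Fq ^ d)) :=
  Finset.prod_range_succ _ _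

theorem X_pow_eq_sum_carlitzLin (t : ℕ+) (i n : ℕ) (hn : i < n) :
    (MvPolynomial.X t ^ i : MvPolynomial ℕ+ (RatFunc Fq))
      = ∑ j ∈ Finset.range n, MvPolynomial.C (carlitzLin Fq j (th Fq ^ i)) * bMv Fq j t := by
  obtain ⟨n, rfl⟩ := Nat.exists_eq_add_of_le' (by omega : 1 ≤ n)
  induction i with
  | zero =>
    rw [Finset.sum_eq_single_of_mem 0 (by simp)]
    · simp [carlitzLin_zero_apply, bMv]
    · intro j _ hj
      rw [(carlitzLin_th_pow Fq 0).2 j (by omega)]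
      simp
  | succ i ih =>
    have h0 := (carlitzLin_th_pow Fq i).2 n (by omega)
    rw [pow_succ', ih (by omega), Finset.sum_range_succ, h0, Finset.sum_range_succ']
    simp only [pow_succ' (th Fq) i, carlitzLin_succ_th_mul, map_add, map_mul, add_mul,
      Finset.sum_add_distrib, carlitzLin_zero_apply, map_zero, zero_mul, add_zero]
    have e (j : ℕ) : MvPolynomial.X t * (MvPolynomial.C (carlitzLin Fq j (th Fq ^ i)) * bMv Fq j t)
        = MvPolynomial.C (th Fq ^ q Fq ^ j) * MvPolynomial.C (carlitzLin Fq j (th Fq ^ i)) *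
            bMv Fq j t
          + MvPolynomial.C (carlitzLin Fq j (th Fq ^ i)) * bMv Fq (j + 1) t := by
      rw [bMv_succ]; ring
    rw [Finset.mul_sum]
    simp_rw [e]
    rw [Finset.sum_add_distrib]
    have h1 := Finset.sum_range_succ' (fun j => MvPolynomial.C (th Fq ^ q Fq ^ j) *
      MvPolynomial.C (carlitzLin Fq j (th Fq ^ i)) * bMv Fq j t) n
    rw [Finset.sum_range_succ, h0] at h1
    simp only [map_zero, mul_zero, zero_mul, add_zero, carlitzLin_zero_apply, pow_zero,
      pow_one] at h1
    rw [h1]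
    ring

theorem carlitzE_eval_mP_eq (j d : ℕ) (c : Fin d → Fq) :
    (carlitzE Fq j).eval (aK Fq (mP Fq d c))
      = carlitzLin Fq j (th Fq ^ d) + ∑ i : Fin d, c i • carlitzLin Fq j (th Fq ^ (i : ℕ)) := by
  have hval : aK Fq (mP Fq d c) = th Fq ^ d + ∑ i : Fin d, c i • th Fq ^ (i : ℕ) := by
    simp only [mP, aK, th, map_add, map_sum, map_mul, map_pow, Algebra.smul_def]
    rfl
  change carlitzLin Fq j _ = _
  simp only [hval, map_add, map_sum, map_smul]

/-- `E_d` is `1` on the monic polynomials of degree `d`. -/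
theorem carlitzE_eval_mP (d : ℕ) (c : Fin d → Fq) :
    (carlitzE Fq d).eval (aK Fq (mP Fq d c)) = 1 := by
  rw [carlitzE_eval_mP_eq, (carlitzLin_th_pow Fq d).1, Finset.sum_eq_zero, add_zero]
  intro i _
  rw [(carlitzLin_th_pow Fq i).2 d i.2, smul_zero]

/-- `a(t)` expanded in the basis `b_j(t)`: the coefficients are the Carlitz values `E_j(a)`. -/
theorem tval_mP (t : ℕ+) (d : ℕ) (c : Fin d → Fq) :
    tval Fq t (mP Fq d c) = bMv Fq d t + ∑ j ∈ Finset.range d,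
      MvPolynomial.C ((carlitzE Fq j).eval (aK Fq (mP Fq d c))) * bMv Fq j t := by
  have hlast := carlitzE_eval_mP Fq d c
  have h := Finset.sum_range_succ (fun j =>
    MvPolynomial.C ((carlitzE Fq j).eval (aK Fq (mP Fq d c))) * bMv Fq j t) d
  rw [hlast, map_one, one_mul] at h
  rw [add_comm, ← h]
  have hval : tval Fq t (mP Fq d c)
      = MvPolynomial.X t ^ d + ∑ i : Fin d, c i • MvPolynomial.X t ^ (i : ℕ) := by
    simp only [mP, tval, Polynomial.eval₂_add, Polynomial.eval₂_finsetSum, Polynomial.eval₂_mul,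
      Polynomial.eval₂_pow, Polynomial.eval₂_X, Polynomial.eval₂_C, Algebra.smul_def]
    rfl
  have hX (i : ℕ) (hi : i ≤ d) := X_pow_eq_sum_carlitzLin Fq t i (d + 1) (by omega)
  rw [hval, hX d le_rfl]
  simp only [carlitzE_eval_mP_eq, map_add, map_sum, add_mul, Finset.sum_add_distrib,
    Finset.sum_mul]
  congr 1
  rw [Finset.sum_comm]
  refine Finset.sum_congr rfl fun i _ => ?_
  rw [hX i i.2.le, Finset.smul_sum]
  refine Finset.sum_congr rfl fun j _ => ?_
  rw [Algebra.smul_def, Algebra.smul_def, map_mul, ← mul_assoc]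
  rfl

theorem natDegree_carlitzE_le (j : ℕ) : (carlitzE Fq j).natDegree ≤ q Fq ^ j := by
  induction j with
  | zero => simp [carlitzE]
  | succ j ih =>
    refine (Polynomial.natDegree_C_mul_le _ _).trans
      ((Polynomial.natDegree_sub_le _ _).trans (max_le ?_ ?_))
    · rw [pow_succ']
      exact Polynomial.natDegree_pow_le.trans (Nat.mul_le_mul_left _ ih)
    · exact ih.trans (Nat.pow_le_pow_right Fintype.card_pos (Nat.le_succ j))

/-- `H_j = ∏_{k<j} (1 - E_k^{q-1})`. -/
def carlitzH (j : ℕ) : (RatFunc Fq)[X] :=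
  ∏ k ∈ Finset.range j, (1 - carlitzE Fq k ^ (q Fq - 1))

theorem carlitzE_eq_prod (j : ℕ) : carlitzE Fq j =
    Polynomial.X * Polynomial.C (∏ k ∈ Finset.range j, (-(brk Fq (k + 1))⁻¹)) * carlitzH Fq j := by
  induction j with
  | zero => simp [carlitzE, carlitzH]
  | succ j ih =>
    have hq : carlitzE Fq j ^ q Fq = carlitzE Fq j ^ (q Fq - 1) * carlitzE Fq j := by
      rw [← pow_succ, Nat.sub_add_cancel Fintype.card_pos]
    rw [carlitzE, hq, carlitzH, Finset.prod_range_succ, Finset.prod_range_succ, ← carlitzH]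
    generalize carlitzE Fq j ^ (q Fq - 1) = Y
    rw [ih]
    simp only [map_mul, map_neg]
    ring

theorem coeff_zero_carlitzH (j : ℕ) : (carlitzH Fq j).coeff 0 = 1 := by
  have hq : q Fq - 1 ≠ 0 := by
    have := Fintype.one_lt_card (α := Fq)
    simp only [q]; omega
  rw [Polynomial.coeff_zero_eq_eval_zero, carlitzH, Polynomial.eval_prod]
  refine Finset.prod_eq_one fun k _ => ?_
  rw [carlitzE_eq_prod]
  simp [hq]

theorem Ssc_one (d : ℕ) : Ssc Fq d 1 = ∏ k ∈ Finset.range d, (-(brk Fq (k + 1))⁻¹) := by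
  classical
  set P : (RatFunc Fq)[X] := 1 - carlitzE Fq d with hP
  have h0 : P.eval 0 = 1 := by
    rw [hP, carlitzE_eq_prod]; simp
  have hP0 : P ≠ 0 := by rintro h; simp [h] at h0
  have hdeg : P.natDegree ≤ q Fq ^ d :=
    (Polynomial.natDegree_sub_le _ _).trans (max_le (by simp) (natDegree_carlitzE_le Fq d))
  let s : Finset (RatFunc Fq) :=
    Finset.univ.map ⟨fun c => aK Fq (mP Fq d c), aK_mP_injective Fq d⟩
  have hs : s.card = q Fq ^ d := by simp [s]
  have hroots : P.roots = s.val := by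
    refine Polynomial.roots_eq_of_natDegree_le_card_of_ne_zero ?_ (by rw [hs]; exact hdeg) hP0
    intro x hx
    obtain ⟨c, -, rfl⟩ := Finset.mem_map.1 hx
    simp [hP, carlitzE_eval_mP]
  have hsplit : P.Splits := by
    rw [Polynomial.splits_iff_card_roots]
    refine le_antisymm (Polynomial.card_roots' P) ?_
    rw [hroots, Finset.card_val, hs]
    exact hdeg
  have h := hsplit.eval_derivative_div_eval_of_ne_zero (x := 0) (by rw [h0]; exact one_ne_zero)
  have hd : P.derivative.eval 0 = -∏ k ∈ Finset.range d, (-(brk Fq (k + 1))⁻¹) := by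
    rw [hP, carlitzE_eq_prod]
    generalize ∏ k ∈ Finset.range d, (-(brk Fq (k + 1))⁻¹) = l
    simp [Polynomial.derivative_mul, ← Polynomial.coeff_zero_eq_eval_zero, coeff_zero_carlitzH]
  rw [h0, div_one, hd, hroots] at h
  rw [← neg_inj, h]
  simp [Ssc, s, Finset.sum_neg_distrib]

theorem carlitzE_eq (j : ℕ) :
    carlitzE Fq j = Polynomial.X * Polynomial.C (Ssc Fq j 1) * carlitzH Fq j := by
  rw [Ssc_one, carlitzE_eq_prod]

/-- The recursion expressing `H_j` through the `H_k` with `k < j`. -/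
theorem carlitzH_eq (j : ℕ) : carlitzH Fq j = 1 - ∑ k ∈ Finset.range j,
    Polynomial.X ^ (q Fq - 1) * (Polynomial.C (Ssc Fq k 1 ^ (q Fq - 1)) * carlitzH Fq k ^ q Fq) := by
  induction j with
  | zero => simp [carlitzH]
  | succ j ih =>
    have hq : carlitzH Fq j ^ q Fq = carlitzH Fq j ^ (q Fq - 1) * carlitzH Fq j := by
      rw [← pow_succ, Nat.sub_add_cancel Fintype.card_pos]
    rw [Finset.sum_range_succ, ← sub_sub, ← ih, hq, carlitzH, Finset.prod_range_succ, ← carlitzH,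
      carlitzE_eq, mul_pow, mul_pow, map_pow]
    ring

/-- The polynomial `P_t(X) = b_d(t) + Σ_{j<d} b_j(t) E_j(X)`, which interpolates `a ↦ a(t)` on
`A^+(d)`. -/
def interpPoly (d : ℕ) (t : ℕ+) : (MvPolynomial ℕ+ (RatFunc Fq))[X] :=
  Polynomial.C (bMv Fq d t) + ∑ j ∈ Finset.range d,
    Polynomial.C (bMv Fq j t) * (carlitzE Fq j).map MvPolynomial.C

theorem eval_interpPoly (d : ℕ) (t : ℕ+) (c : Fin d → Fq) :
    (interpPoly Fq d t).eval (MvPolynomial.C (aK Fq (mP Fq d c))) = tval Fq t (mP Fq d c) := by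
  rw [tval_mP, interpPoly, Polynomial.eval_add, Polynomial.eval_C, Polynomial.eval_finsetSum]
  simp only [Polynomial.eval_mul, Polynomial.eval_C, Polynomial.eval_map_apply, mul_comm]

theorem card_mul_natDegree_interpPoly_le (d : ℕ) (t : ℕ+) :
    q Fq * (interpPoly Fq d t).natDegree ≤ q Fq ^ d := by
  rcases d with _ | d
  · simp [interpPoly]
  · rw [pow_succ']
    refine Nat.mul_le_mul_left _ ((Polynomial.natDegree_add_le _ _).trans (max_le (by simp) ?_))
    refine Polynomial.natDegree_sum_le_of_forall_le _ _ fun j hj => ?_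
    exact (Polynomial.natDegree_C_mul_le _ _).trans (Polynomial.natDegree_map_le.trans
      ((natDegree_carlitzE_le Fq j).trans
        (Nat.pow_le_pow_right Fintype.card_pos (Nat.lt_succ_iff.1 (Finset.mem_range.1 hj)))))

theorem natDegree_prod_interpPoly_lt (d : ℕ) (Sg : Finset ℕ+) (hSg : Sg.card < q Fq) :
    (∏ t ∈ Sg, interpPoly Fq d t).natDegree < q Fq ^ d := by
  have h : q Fq * (∏ t ∈ Sg, interpPoly Fq d t).natDegree ≤ Sg.card * q Fq ^ d := by
    refine (Nat.mul_le_mul_left _ (Polynomial.natDegree_prod_le _ _)).trans ?_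
    rw [Finset.mul_sum, ← smul_eq_mul (Sg.card)]
    exact Finset.sum_le_card_nsmul _ _ _ fun t _ => card_mul_natDegree_interpPoly_le Fq d t
  have hpos : 0 < q Fq ^ d := Nat.pow_pos Fintype.card_pos
  exact Nat.lt_of_mul_lt_mul_left (h.trans_lt (Nat.mul_lt_mul_of_pos_right hSg hpos))

/-- For `|Σ| < q`, the depth-one power sums of type `Σ` in terms of the scalar ones. -/
theorem S1F_eq_sum (Sg : Finset ℕ+) (hSg : Sg.card < q Fq) (s : ℕ) (hs : 1 ≤ s) (d : ℕ) :
    S1F Fq d Sg s = ∑ i ∈ Finset.range s,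
      (∏ t ∈ Sg, interpPoly Fq d t).coeff i * MvPolynomial.C (Ssc Fq d (s - i)) := by
  set P := ∏ t ∈ Sg, interpPoly Fq d t with hP
  have hdeg : P.natDegree < q Fq ^ d := natDegree_prod_interpPoly_lt Fq d Sg hSg
  have heval (c : Fin d → Fq) : ∏ t ∈ Sg, tval Fq t (mP Fq d c) =
      ∑ i ∈ Finset.range (max s (q Fq ^ d)),
        P.coeff i * MvPolynomial.C (aK Fq (mP Fq d c) ^ i) := by
    simp only [← eval_interpPoly, ← Polynomial.eval_prod, ← hP]
    rw [Polynomial.eval_eq_sum_range' (hdeg.trans_le (le_max_right s _))]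
    simp only [map_pow]
  have hsum : S1F Fq d Sg s = ∑ i ∈ Finset.range (max s (q Fq ^ d)), P.coeff i *
      MvPolynomial.C (∑ c : Fin d → Fq, aK Fq (mP Fq d c) ^ i * (aK Fq (mP Fq d c) ^ s)⁻¹) := by
    simp only [S1F, heval, Finset.sum_mul, map_sum, Finset.mul_sum]
    rw [Finset.sum_comm]
    simp only [map_mul, mul_assoc]
  rw [hsum]
  symm
  refine (Finset.sum_congr rfl fun i hi => ?_).trans
    (Finset.sum_subset (Finset.range_subset_range.2 (le_max_left _ _)) fun i hi his => ?_)
  · have his := Finset.mem_range.1 hi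
    rw [Ssc]
    congr 2
    refine Finset.sum_congr rfl fun c _ => ?_
    have h0 := aK_mP_ne_zero Fq d c
    rw [pow_sub₀ _ h0 his.le]
    field_simp
  · rw [Finset.mem_range, not_lt] at his
    rcases lt_or_ge i (q Fq ^ d) with hiq | hiq
    · have : ∑ c : Fin d → Fq, aK Fq (mP Fq d c) ^ i * (aK Fq (mP Fq d c) ^ s)⁻¹ = 0 := by
        rw [← sum_aK_mP_pow_eq_zero Fq d (i - s) (by omega)]
        exact Finset.sum_congr rfl fun c _ => (pow_sub₀ _ (aK_mP_ne_zero Fq d c) his).symm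
      rw [this, map_zero, mul_zero]
    · rw [Polynomial.coeff_eq_zero_of_natDegree_lt (hdeg.trans_le hiq), zero_mul]

/-- The partial sums `(J f)(d) = Σ_{k<d} f(k)`. -/
def partialSum : (ℕ → MvPolynomial ℕ+ (RatFunc Fq)) →ₗ[Fq] (ℕ → MvPolynomial ℕ+ (RatFunc Fq)) where
  toFun f d := ∑ k ∈ Finset.range d, f k
  map_add' f g := by ext1 d; simp [Finset.sum_add_distrib]
  map_smul' a f := by ext1 d; simp [Finset.smul_sum]

theorem partialSum_apply (f : ℕ → MvPolynomial ℕ+ (RatFunc Fq)) (d : ℕ) :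
    partialSum Fq f d = ∑ k ∈ Finset.range d, f k := rfl

/-- Products of partial sums (quasi-shuffle). -/
theorem partialSum_mul_partialSum (f g : ℕ → MvPolynomial ℕ+ (RatFunc Fq)) :
    partialSum Fq f * partialSum Fq g
      = partialSum Fq (f * partialSum Fq g + g * partialSum Fq f + f * g) := by
  ext1 d
  induction d with
  | zero => simp [partialSum_apply]
  | succ d ih =>
    simp only [Pi.mul_apply, partialSum_apply, Pi.add_apply, Finset.sum_range_succ] at ih ⊢
    rw [← ih]
    ring

/-- `S_d†(Σ; s)` as a function of `d`. -/
def dagger (Sg : Finset ℕ+) (s : ℕ) : ℕ → MvPolynomial ℕ+ (RatFunc Fq) := fun d => S1D Fq d Sg s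

/-- The sums `S_{<d}†(𝙰)`, with value `1` for the empty array. -/
def daggerLT : List (Finset ℕ+ × ℕ) → ℕ → MvPolynomial ℕ+ (RatFunc Fq)
  | [] => 1
  | x :: L => partialSum Fq (dagger Fq x.1 x.2 * daggerLT L)

theorem SPD_cons (x : Finset ℕ+ × ℕ) (L : List (Finset ℕ+ × ℕ)) :
    SPD Fq (x :: L) = dagger Fq x.1 x.2 * daggerLT Fq L := by
  induction L generalizing x with
  | nil => ext1 d; simp [SPD, daggerLT, dagger]
  | cons y L ih =>
    ext1 d
    rw [SPD, ih]
    rfl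

theorem isCompF_nil : IsCompF [] ∅ 0 := by simp [IsCompF]

theorem disjoint_foldr_union_iff (A : Finset ℕ+) (L : List (Finset ℕ+ × ℕ)) :
    Disjoint A ((L.map Prod.fst).foldr (· ∪ ·) ∅) ↔ ∀ x ∈ L, Disjoint A x.1 := by
  induction L with
  | nil => simp
  | cons y L ih => simp [Finset.disjoint_union_right, ih]

theorem IsCompF.cons {L : List (Finset ℕ+ × ℕ)} {A Sg : Finset ℕ+} {s w : ℕ}
    (hL : IsCompF L Sg w) (hA : Disjoint A Sg) (hs : 1 ≤ s) :
    IsCompF ((A, s) :: L) (A ∪ Sg) (s + w) := by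
  obtain ⟨h1, h2, rfl, rfl⟩ := hL
  refine ⟨by simpa [hs] using h1, ?_, by simp, by simp⟩
  rw [List.pairwise_cons]
  exact ⟨(disjoint_foldr_union_iff A L).1 hA, h2⟩

theorem IsCompF.of_cons {L : List (Finset ℕ+ × ℕ)} {x : Finset ℕ+ × ℕ} {Sg : Finset ℕ+} {w : ℕ}
    (h : IsCompF (x :: L) Sg w) : 1 ≤ x.2 ∧ ∃ (Sg' : Finset ℕ+) (w' : ℕ), IsCompF L Sg' w' ∧
      Disjoint x.1 Sg' ∧ Sg = x.1 ∪ Sg' ∧ w = x.2 + w' := by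
  obtain ⟨h1, h2, rfl, rfl⟩ := h
  rw [List.pairwise_cons] at h2
  exact ⟨h1 x (by simp), _, _, ⟨fun y hy => h1 y (by simp [hy]), h2.2, rfl, rfl⟩,
    (disjoint_foldr_union_iff x.1 L).2 h2.1, by simp, by simp⟩

/-- The `F_q`-span of the functions `d ↦ S_d†(𝙱)`, for nonempty compositions `𝙱` of `(Σ, w)`. -/
def daggerSpan (Sg : Finset ℕ+) (w : ℕ) : Submodule Fq (ℕ → MvPolynomial ℕ+ (RatFunc Fq)) :=
  Submodule.span Fq (SPD Fq '' {L | L ≠ [] ∧ IsCompF L Sg w})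

/-- The `F_q`-span of the functions `d ↦ S_{<d}†(𝙱)`, for compositions `𝙱` of `(Σ, w)`. -/
def daggerLTSpan (Sg : Finset ℕ+) (w : ℕ) : Submodule Fq (ℕ → MvPolynomial ℕ+ (RatFunc Fq)) :=
  Submodule.span Fq (daggerLT Fq '' {L | IsCompF L Sg w})

theorem one_mem_daggerLTSpan : 1 ∈ daggerLTSpan Fq ∅ 0 :=
  Submodule.subset_span ⟨[], isCompF_nil, rfl⟩

theorem dagger_mul_mem {A Sg : Finset ℕ+} {s w : ℕ} (hA : Disjoint A Sg) (hs : 1 ≤ s)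
    {f : ℕ → MvPolynomial ℕ+ (RatFunc Fq)} (hf : f ∈ daggerLTSpan Fq Sg w) :
    dagger Fq A s * f ∈ daggerSpan Fq (A ∪ Sg) (s + w) := by
  induction hf using Submodule.span_induction with
  | mem f hf =>
    obtain ⟨L, hL, rfl⟩ := hf
    exact Submodule.subset_span ⟨(A, s) :: L, ⟨by simp, hL.cons hA hs⟩, SPD_cons Fq _ _⟩
  | zero => simp
  | add f g _ _ hf hg => rw [mul_add]; exact add_mem hf hg
  | smul a f _ hf => rw [mul_smul_comm]; exact Submodule.smul_mem _ _ hf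

theorem partialSum_mem {Sg : Finset ℕ+} {w : ℕ} {f : ℕ → MvPolynomial ℕ+ (RatFunc Fq)}
    (hf : f ∈ daggerSpan Fq Sg w) : partialSum Fq f ∈ daggerLTSpan Fq Sg w := by
  induction hf using Submodule.span_induction with
  | mem f hf =>
    obtain ⟨L, ⟨h0, hL⟩, rfl⟩ := hf
    obtain ⟨x, L, rfl⟩ := List.exists_cons_of_ne_nil h0
    exact Submodule.subset_span ⟨x :: L, hL, by rw [SPD_cons, daggerLT]⟩
  | zero => simp
  | add f g _ _ hf hg => rw [map_add]; exact add_mem hf hg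
  | smul a f _ hf => rw [map_smul]; exact Submodule.smul_mem _ _ hf

theorem partialSum_dagger_mem (j : ℕ) (hj : 1 ≤ j) :
    partialSum Fq (dagger Fq ∅ j) ∈ daggerLTSpan Fq ∅ j := by
  have := dagger_mul_mem Fq (Finset.disjoint_empty_right ∅) hj (one_mem_daggerLTSpan Fq)
  simpa using partialSum_mem Fq this

theorem smul_eq_C_FqK_mul (a : Fq) (y : MvPolynomial ℕ+ (RatFunc Fq)) :
    a • y = MvPolynomial.C (FqK Fq a) * y := Algebra.smul_def a y

/-- The product of two depth-one dagger sums of the same degree and disjoint types. -/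
theorem exists_dagger_mul_dagger (s r : ℕ) (hs : 1 ≤ s) (hr : 1 ≤ r) :
    ∃ δ : ℕ → Fq, ∀ A B : Finset ℕ+, Disjoint A B →
      dagger Fq A s * dagger Fq B r = dagger Fq (A ∪ B) (s + r) +
        ∑ j ∈ Finset.Ico 1 (s + r),
          δ j • (dagger Fq (A ∪ B) (s + r - j) * partialSum Fq (dagger Fq ∅ j)) := by
  obtain ⟨δ, hδ⟩ := exists_Ssc_mul Fq s r hs hr
  refine ⟨δ, fun A B hAB => funext fun d => ?_⟩
  have h := congrArg (MvPolynomial.C (σ := ℕ+)) (hδ d)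
  simp only [map_mul, map_add, map_sum] at h
  simp only [Pi.mul_apply, Pi.add_apply, Finset.sum_apply, Pi.smul_apply, smul_eq_C_FqK_mul,
    dagger, S1D, partialSum_apply, Finset.prod_empty, mul_one, Finset.prod_union hAB]
  generalize ∏ i ∈ A, bMv Fq d i = bA
  generalize ∏ i ∈ B, bMv Fq d i = bB
  rw [mul_mul_mul_comm, h, add_mul, Finset.sum_mul]
  refine congrArg₂ (· + ·) rfl (Finset.sum_congr rfl fun j _ => ?_)
  rw [mul_assoc, mul_right_comm (MvPolynomial.C (Ssc Fq d (s + r - j)))]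

theorem dagger_mul_dagger_mul_mem {A B Sg : Finset ℕ+} {s r w : ℕ} (hs : 1 ≤ s) (hr : 1 ≤ r)
    (hAB : Disjoint A B) (hSg : Disjoint (A ∪ B) Sg) {h : ℕ → MvPolynomial ℕ+ (RatFunc Fq)}
    (hh : h ∈ daggerLTSpan Fq Sg w)
    (hmul : ∀ j, j < s + r → daggerLTSpan Fq ∅ j * daggerLTSpan Fq Sg w
      ≤ daggerLTSpan Fq Sg (j + w)) :
    dagger Fq A s * dagger Fq B r * h ∈ daggerSpan Fq (A ∪ B ∪ Sg) (s + r + w) := by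
  obtain ⟨δ, hδ⟩ := exists_dagger_mul_dagger Fq s r hs hr
  rw [hδ A B hAB, add_mul, Finset.sum_mul]
  refine add_mem (dagger_mul_mem Fq hSg (by omega) hh) (Submodule.sum_mem _ fun j hj => ?_)
  obtain ⟨hj1, hj2⟩ := Finset.mem_Ico.1 hj
  rw [smul_mul_assoc, mul_assoc]
  refine Submodule.smul_mem _ _ ?_
  have := dagger_mul_mem Fq hSg (by omega : 1 ≤ s + r - j)
    (hmul j hj2 (Submodule.mul_mem_mul (partialSum_dagger_mem Fq j hj1) hh))
  rwa [show s + r - j + (j + w) = s + r + w by omega] at this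

theorem daggerLTSpan_mul_le_of_lt (n : ℕ) : ∀ {A B : Finset ℕ+} {w v : ℕ}, w + v < n →
    Disjoint A B → daggerLTSpan Fq A w * daggerLTSpan Fq B v ≤ daggerLTSpan Fq (A ∪ B) (w + v) := by
  induction n with
  | zero => intro A B w v h; omega
  | succ n ih =>
    intro A B w v hn hAB
    rw [daggerLTSpan, daggerLTSpan, Submodule.span_mul_span, Submodule.span_le]
    rintro _ ⟨_, ⟨L, hL, rfl⟩, _, ⟨L', hL', rfl⟩, rfl⟩
    change daggerLT Fq L * daggerLT Fq L' ∈ daggerLTSpan Fq (A ∪ B) (w + v)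
    rcases L with _ | ⟨x, L⟩
    · obtain ⟨-, -, rfl, rfl⟩ := hL
      refine Submodule.subset_span ⟨L', ?_, (one_mul _).symm⟩
      simpa using hL'
    rcases L' with _ | ⟨y, L'⟩
    · obtain ⟨-, -, rfl, rfl⟩ := hL'
      refine Submodule.subset_span ⟨x :: L, ?_, (mul_one _).symm⟩
      simpa using hL
    have mem {L : List (Finset ℕ+ × ℕ)} {Sg : Finset ℕ+} {w : ℕ} (h : IsCompF L Sg w) :
        daggerLT Fq L ∈ daggerLTSpan Fq Sg w := Submodule.subset_span ⟨L, h, rfl⟩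
    have hxL := mem hL
    have hyL := mem hL'
    obtain ⟨hx, A', w', hL1, hA', rfl, rfl⟩ := IsCompF.of_cons hL
    obtain ⟨hy, B', v', hL2, hB', rfl, rfl⟩ := IsCompF.of_cons hL'
    simp only [Finset.disjoint_union_left, Finset.disjoint_union_right] at hAB
    obtain ⟨⟨hxy, hA'y⟩, hxB', hA'B'⟩ := hAB
    have h1 : dagger Fq x.1 x.2 * (daggerLT Fq L * daggerLT Fq (y :: L'))
        ∈ daggerSpan Fq (x.1 ∪ A' ∪ (y.1 ∪ B')) (x.2 + w' + (y.2 + v')) := by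
      rw [Finset.union_assoc, add_assoc]
      refine dagger_mul_mem Fq ?_ hx (ih ?_ ?_ (Submodule.mul_mem_mul (mem hL1) hyL))
      · simp [*]
      · omega
      · simp [*]
    have h2 : dagger Fq y.1 y.2 * (daggerLT Fq (x :: L) * daggerLT Fq L')
        ∈ daggerSpan Fq (x.1 ∪ A' ∪ (y.1 ∪ B')) (x.2 + w' + (y.2 + v')) := by
      rw [Finset.union_left_comm, add_left_comm]
      refine dagger_mul_mem Fq ?_ hy (ih ?_ ?_ (Submodule.mul_mem_mul hxL (mem hL2)))
      · simp [*, hxy.symm, hA'y.symm]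
      · omega
      · simp [*]
    have h3 : dagger Fq x.1 x.2 * dagger Fq y.1 y.2 * (daggerLT Fq L * daggerLT Fq L')
        ∈ daggerSpan Fq (x.1 ∪ A' ∪ (y.1 ∪ B')) (x.2 + w' + (y.2 + v')) := by
      rw [Finset.union_union_union_comm, add_add_add_comm]
      refine dagger_mul_dagger_mul_mem Fq hx hy hxy ?_
        (ih (by omega) hA'B' (Submodule.mul_mem_mul (mem hL1) (mem hL2))) fun j hj => ?_
      · simp [*, hA'y.symm]
      · simpa using ih (A := ∅) (B := A' ∪ B') (w := j) (v := w' + v') (by omega) (by simp)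
    have h := partialSum_mem Fq (add_mem (add_mem h1 h2) h3)
    have e : daggerLT Fq (x :: L) * daggerLT Fq (y :: L')
        = partialSum Fq (dagger Fq x.1 x.2 * (daggerLT Fq L * daggerLT Fq (y :: L'))
          + dagger Fq y.1 y.2 * (daggerLT Fq (x :: L) * daggerLT Fq L')
          + dagger Fq x.1 x.2 * dagger Fq y.1 y.2 * (daggerLT Fq L * daggerLT Fq L')) := by
      rw [daggerLT, daggerLT, partialSum_mul_partialSum]
      refine congrArg (partialSum Fq) ?_
      ring
    rw [e]
    exact h

theorem daggerLTSpan_mul_mem {A B : Finset ℕ+} {w v : ℕ} (hAB : Disjoint A B)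
    {f g : ℕ → MvPolynomial ℕ+ (RatFunc Fq)} (hf : f ∈ daggerLTSpan Fq A w)
    (hg : g ∈ daggerLTSpan Fq B v) : f * g ∈ daggerLTSpan Fq (A ∪ B) (w + v) :=
  daggerLTSpan_mul_le_of_lt Fq (w + v + 1) (Nat.lt_succ_self _) hAB (Submodule.mul_mem_mul hf hg)

theorem daggerSpan_induction {Sg : Finset ℕ+} {w : ℕ}
    {N : Submodule Fq (ℕ → MvPolynomial ℕ+ (RatFunc Fq))} {g : ℕ → MvPolynomial ℕ+ (RatFunc Fq)}
    (h : ∀ (A Sg' : Finset ℕ+) (s w' : ℕ) (f : ℕ → MvPolynomial ℕ+ (RatFunc Fq)), 1 ≤ s →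
      Disjoint A Sg' → Sg = A ∪ Sg' → w = s + w' → f ∈ daggerLTSpan Fq Sg' w' →
      dagger Fq A s * f * g ∈ N)
    {f : ℕ → MvPolynomial ℕ+ (RatFunc Fq)} (hf : f ∈ daggerSpan Fq Sg w) : f * g ∈ N := by
  induction hf using Submodule.span_induction with
  | mem f hf =>
    obtain ⟨L, ⟨h0, hL⟩, rfl⟩ := hf
    obtain ⟨x, L, rfl⟩ := List.exists_cons_of_ne_nil h0
    obtain ⟨hx, Sg', w', hL', hd, h1, h2⟩ := hL.of_cons
    rw [SPD_cons]
    exact h _ _ _ _ _ hx hd h1 h2 (Submodule.subset_span ⟨L, hL', rfl⟩)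
  | zero => simp
  | add f g _ _ hf hg => rw [add_mul]; exact add_mem hf hg
  | smul a f _ hf => rw [smul_mul_assoc]; exact Submodule.smul_mem _ _ hf

theorem daggerSpan_mul_daggerLTSpan_mem {A B : Finset ℕ+} {w v : ℕ} (hAB : Disjoint A B)
    {f g : ℕ → MvPolynomial ℕ+ (RatFunc Fq)} (hf : f ∈ daggerSpan Fq A w)
    (hg : g ∈ daggerLTSpan Fq B v) : f * g ∈ daggerSpan Fq (A ∪ B) (w + v) := by
  refine daggerSpan_induction Fq (fun C C' s w' f' hs hC hA hw hf' => ?_) hf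
  subst hA hw
  rw [Finset.disjoint_union_left] at hAB
  rw [mul_assoc, Finset.union_assoc, add_assoc]
  refine dagger_mul_mem Fq ?_ hs (daggerLTSpan_mul_mem Fq hAB.2 hf' hg)
  simp [hC, hAB.1]

theorem dagger_mul_daggerSpan_mem {A B : Finset ℕ+} {s v : ℕ} (hs : 1 ≤ s) (hAB : Disjoint A B)
    {g : ℕ → MvPolynomial ℕ+ (RatFunc Fq)} (hg : g ∈ daggerSpan Fq B v) :
    g * dagger Fq A s ∈ daggerSpan Fq (A ∪ B) (s + v) := by
  refine daggerSpan_induction Fq (fun C C' r v' f hr hC hB hv hf => ?_) hg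
  subst hB hv
  rw [Finset.disjoint_union_right] at hAB
  rw [mul_right_comm, mul_comm (dagger Fq C r), ← Finset.union_assoc, ← add_assoc]
  refine dagger_mul_dagger_mul_mem Fq hs hr hAB.1 (by simp [hC, hAB.2]) hf fun j _ => ?_
  rw [Submodule.mul_le]
  intro f hf g hg
  simpa using daggerLTSpan_mul_mem Fq (Finset.disjoint_empty_left C') hf hg

theorem dagger_pow_mem (m : ℕ) : dagger Fq ∅ 1 ^ (m + 1) ∈ daggerSpan Fq ∅ (m + 1) := by
  induction m with
  | zero =>
    simpa using dagger_mul_mem Fq (Finset.disjoint_empty_right ∅) le_rfl (one_mem_daggerLTSpan Fq)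
  | succ m ih =>
    rw [pow_succ, add_comm (m + 1)]
    simpa using dagger_mul_daggerSpan_mem Fq le_rfl (Finset.disjoint_empty_left ∅) ih

theorem coeff_pow_mem (G : ℕ → (RatFunc Fq)[X]) (n : ℕ)
    (hG : ∀ i ≤ n, (fun j => MvPolynomial.C ((G j).coeff i)) ∈ daggerLTSpan Fq ∅ i) (m : ℕ) :
    ∀ i ≤ n, (fun j => MvPolynomial.C ((G j ^ m).coeff i)) ∈ daggerLTSpan Fq ∅ i := by
  induction m with
  | zero =>
    intro i _
    rcases Nat.eq_zero_or_pos i with rfl | hi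
    · simp only [pow_zero, Polynomial.coeff_one_zero, map_one]
      exact one_mem_daggerLTSpan Fq
    · simp only [pow_zero, Polynomial.coeff_one, hi.ne', if_false, map_zero]
      exact zero_mem _
  | succ m ih =>
    intro i hi
    have e : (fun j => MvPolynomial.C ((G j ^ (m + 1)).coeff i))
        = ∑ p ∈ Finset.HasAntidiagonal.antidiagonal i, (fun j => MvPolynomial.C ((G j ^ m).coeff p.1)) *
          (fun j => (MvPolynomial.C ((G j).coeff p.2) : MvPolynomial ℕ+ (RatFunc Fq))) := by
      ext1 j
      simp [pow_succ, Polynomial.coeff_mul]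
    rw [e]
    refine Submodule.sum_mem _ fun p hp => ?_
    have hp' := Finset.HasAntidiagonal.mem_antidiagonal.1 hp
    rw [← hp']
    simpa using daggerLTSpan_mul_mem Fq (Finset.disjoint_empty_left ∅) (ih p.1 (by omega))
      (hG p.2 (by omega))

/-- The `n`-th coefficient of `H_j` is, as a function of `j`, a combination of the sums
`S_{<j}†(𝙱)` of weight `n` and empty type. -/
theorem coeff_carlitzH_mem (n : ℕ) :
    (fun j => MvPolynomial.C ((carlitzH Fq j).coeff n)) ∈ daggerLTSpan Fq ∅ n := by
  induction n using Nat.strong_induction_on with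
  | _ n ih =>
    rcases Nat.eq_zero_or_pos n with rfl | hn
    · simp only [coeff_zero_carlitzH, map_one]
      exact one_mem_daggerLTSpan Fq
    obtain ⟨m, hm⟩ : ∃ m, q Fq - 1 = m + 1 :=
      ⟨q Fq - 2, by have := Fintype.one_lt_card (α := Fq); simp only [q]; omega⟩
    rcases lt_or_ge n (m + 1) with hnm | hnm
    · have e : (fun j => (MvPolynomial.C ((carlitzH Fq j).coeff n) :
          MvPolynomial ℕ+ (RatFunc Fq))) = 0 := by
        ext1 j
        rw [carlitzH_eq, hm]
        simp [Polynomial.coeff_one, hn.ne', Polynomial.coeff_X_pow_mul', hnm.not_ge]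
      rw [e]
      exact zero_mem _
    · have e : (fun j => (MvPolynomial.C ((carlitzH Fq j).coeff n) :
          MvPolynomial ℕ+ (RatFunc Fq))) = -partialSum Fq (dagger Fq ∅ 1 ^ (m + 1) *
            fun k => MvPolynomial.C ((carlitzH Fq k ^ q Fq).coeff (n - (m + 1)))) := by
        ext1 j
        rw [carlitzH_eq, hm]
        simp only [Polynomial.coeff_sub, Polynomial.coeff_one, hn.ne', if_false, zero_sub,
          Polynomial.finsetSum_coeff, Polynomial.coeff_X_pow_mul', hnm, if_true,
          Polynomial.coeff_C_mul, map_neg, map_sum, map_mul, Pi.neg_apply, partialSum_apply,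
          Pi.mul_apply, Pi.pow_apply, dagger, S1D, Finset.prod_empty, mul_one,
          MvPolynomial.C_pow]
      have hpow := coeff_pow_mem Fq (carlitzH Fq) (n - (m + 1)) (fun i hi => ih i (by omega)) (q Fq)
        _ le_rfl
      have := partialSum_mem Fq (daggerSpan_mul_daggerLTSpan_mem Fq (Finset.disjoint_empty_left ∅)
        (dagger_pow_mem Fq m) hpow)
      rw [e]
      refine neg_mem ?_
      rwa [Finset.union_empty, Nat.add_sub_cancel' hnm] at this

theorem coeff_zero_interpPoly (d : ℕ) (t : ℕ+) : (interpPoly Fq d t).coeff 0 = bMv Fq d t := by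
  simp [interpPoly, carlitzE_eq]

theorem coeff_succ_interpPoly_mem (t : ℕ+) (i : ℕ) :
    (fun d => (interpPoly Fq d t).coeff (i + 1)) ∈ daggerLTSpan Fq {t} (i + 1) := by
  have e : (fun d => (interpPoly Fq d t).coeff (i + 1)) = partialSum Fq
      (dagger Fq {t} 1 * fun j => MvPolynomial.C ((carlitzH Fq j).coeff i)) := by
    ext1 d
    simp only [interpPoly, carlitzE_eq, Polynomial.coeff_add, Polynomial.coeff_C_succ, zero_add,
      Polynomial.finsetSum_coeff, Polynomial.coeff_C_mul, Polynomial.coeff_map, mul_assoc,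
      Polynomial.coeff_X_mul, partialSum_apply, Pi.mul_apply, dagger, S1D, Finset.prod_singleton,
      map_mul]
    exact Finset.sum_congr rfl fun j _ => mul_left_comm _ _ _
  rw [e, add_comm]
  simpa using partialSum_mem Fq
    (dagger_mul_mem Fq (Finset.disjoint_empty_right {t}) le_rfl (coeff_carlitzH_mem Fq i))

theorem dagger_mul_coeff_prod_interpPoly_mem (Sg : Finset ℕ+) : ∀ (A : Finset ℕ+) (s i : ℕ),
    1 ≤ s → Disjoint A Sg → (dagger Fq A s * fun d => (∏ t ∈ Sg, interpPoly Fq d t).coeff i)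
      ∈ daggerSpan Fq (A ∪ Sg) (s + i) := by
  induction Sg using Finset.induction_on with
  | empty =>
    intro A s i hs hA
    refine dagger_mul_mem Fq hA hs ?_
    rcases Nat.eq_zero_or_pos i with rfl | hi
    · simp only [Finset.prod_empty, Polynomial.coeff_one_zero]
      exact one_mem_daggerLTSpan Fq
    · simp only [Finset.prod_empty, Polynomial.coeff_one, hi.ne', if_false]
      exact zero_mem _
  | insert t Sg ht ih =>
    intro A s i hs hA
    rw [Finset.disjoint_insert_right] at hA
    have e : (fun d => (∏ x ∈ insert t Sg, interpPoly Fq d x).coeff i)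
        = ∑ p ∈ Finset.HasAntidiagonal.antidiagonal i, (fun d => (interpPoly Fq d t).coeff p.1) *
          fun d => (∏ x ∈ Sg, interpPoly Fq d x).coeff p.2 := by
      ext1 d
      simp [Finset.prod_insert ht, Polynomial.coeff_mul]
    rw [e, Finset.mul_sum]
    refine Submodule.sum_mem _ fun p hp => ?_
    obtain ⟨i₁, i₂⟩ := p
    obtain rfl : i₁ + i₂ = i := Finset.HasAntidiagonal.mem_antidiagonal.1 hp
    rcases i₁ with _ | i₁
    · have hb : dagger Fq A s * (fun d => (interpPoly Fq d t).coeff 0)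
          = dagger Fq (insert t A) s := by
        ext1 d
        simp only [coeff_zero_interpPoly, Pi.mul_apply, dagger, S1D, Finset.prod_insert hA.1]
        ring
      have := ih (insert t A) s i₂ hs (by simp [ht, hA.2])
      rw [← mul_assoc, hb, zero_add, ← Finset.insert_union_comm]
      exact this
    · have := daggerSpan_mul_daggerLTSpan_mem Fq (by simp [ht, hA.1] : Disjoint (A ∪ Sg) {t})
        (ih A s i₂ hs hA.2) (coeff_succ_interpPoly_mem Fq t i₁)
      rw [mul_left_comm, mul_comm (fun d => (interpPoly Fq d t).coeff (i₁ + 1))]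
      convert this using 2
      · grind
      · ring

theorem S1F_mem (Sg : Finset ℕ+) (hSg : Sg.card < q Fq) (s : ℕ) (hs : 1 ≤ s) :
    (fun d => S1F Fq d Sg s) ∈ daggerSpan Fq Sg s := by
  have e : (fun d => S1F Fq d Sg s) = ∑ i ∈ Finset.range s,
      dagger Fq ∅ (s - i) * fun d => (∏ t ∈ Sg, interpPoly Fq d t).coeff i := by
    ext1 d
    simp [S1F_eq_sum Fq Sg hSg s hs d, dagger, S1D, mul_comm]
  rw [e]
  refine Submodule.sum_mem _ fun i hi => ?_
  have hi := Finset.mem_range.1 hi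
  have := dagger_mul_coeff_prod_interpPoly_mem Fq Sg ∅ (s - i) i (by omega)
    (Finset.disjoint_empty_left Sg)
  rwa [Finset.empty_union, Nat.sub_add_cancel hi.le] at this

theorem SPF_mem (L : List (Finset ℕ+ × ℕ)) : ∀ (Sg : Finset ℕ+) (w : ℕ), L ≠ [] →
    IsCompF L Sg w → Sg.card < q Fq → SPF Fq L ∈ daggerSpan Fq Sg w := by
  induction L with
  | nil => intro _ _ h; exact absurd rfl h
  | cons x L ih =>
    intro Sg w _ hL hSg
    obtain ⟨hx, Sg', w', hL', hd, rfl, rfl⟩ := hL.of_cons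
    have h1 := S1F_mem Fq x.1 ((Finset.card_le_card Finset.subset_union_left).trans_lt hSg) x.2 hx
    rcases L with _ | ⟨y, L⟩
    · obtain ⟨-, -, rfl, rfl⟩ := hL'
      have e : SPF Fq [x] = fun d => S1F Fq d x.1 x.2 := by ext1 d; rw [SPF]
      simpa [e] using h1
    · have h2 := ih Sg' w' (by simp) hL'
        ((Finset.card_le_card Finset.subset_union_right).trans_lt hSg)
      have e : SPF Fq (x :: y :: L)
          = (fun d => S1F Fq d x.1 x.2) * partialSum Fq (SPF Fq (y :: L)) := by
        ext1 d; rw [SPF]; rfl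
      rw [e]
      exact daggerSpan_mul_daggerLTSpan_mem Fq hd h1 (partialSum_mem Fq h2)

theorem statement14 (Sg : Finset ℕ+) (hSg : Sg.card < q Fq) (w : ℕ) (hw : 1 ≤ w)
    (A : List (Finset ℕ+ × ℕ)) (hA : IsCompF A Sg w) :
    ∃ (m : ℕ) (α : Fin m → Fq) (Bs : Fin m → List (Finset ℕ+ × ℕ)),
      (∀ i, IsCompF (Bs i) Sg w) ∧
      ∀ d : ℕ, SPF Fq A d = ∑ i, MvPolynomial.C (FqK Fq (α i)) * SPD Fq (Bs i) d := by
  have hne : A ≠ [] := by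
    rintro rfl
    obtain ⟨-, -, -, rfl⟩ := hA
    simp at hw
  obtain ⟨m, α, g, hg⟩ := Submodule.mem_span_set'.1 (SPF_mem Fq A Sg w hne hA hSg)
  choose Bs hBs hval using fun i => (g i).2
  refine ⟨m, α, Bs, fun i => (hBs i).2, fun d => ?_⟩
  rw [← hg]
  simp [← hval, smul_eq_C_FqK_mul]

end
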